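/- arXiv:1112.2482 — 7 statements merged into one kernel-verified Lean document; each statement's English description precedes it below -/
import Mathlib

section
/- Let R₀ > 0 and let h : ℝ → ℝ be a smooth 2π-periodic function with 0 < h(θ) < R₀ for all θ. Let r̄ > 0 and let gₙ ∈ BV_♯(ℝ) be a sequence with gₙ ≤ h + 1/n for every n, such that each set F_{gₙ} satisfies the uniform exterior ball condition with radius r̄. If ∫₀^{2π} |gₙ(θ) − h(θ)| dθ → 0 and ℋ¹(Γ_{gₙ} ∪ Σ_{gₙ}) → ℋ¹(Γ_h) as n → ∞, then sup_ℝ |gₙ − h| → 0; moreover there exist L > 0 and N ∈ ℕ such that gₙ is Lipschitz continuous with Lipschitz constant at most L for every n ≥ N. -/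
open Real MeasureTheory Filter Set Metric

noncomputable section

/-- The point on the unit circle at angle `θ`, as an element of the Euclidean plane. -/
def sig (θ : ℝ) : EuclideanSpace ℝ (Fin 2) :=
  (EuclideanSpace.equiv (Fin 2) ℝ).symm ![Real.cos θ, Real.sin θ]

/-- `g ∈ BV_♯(ℝ)`: upper semicontinuous, `2π`-periodic, with values in `[0, R₀]` and
finite pointwise total variation on `[0, 2π]`. -/
def BVsharp (R₀ : ℝ) (g : ℝ → ℝ) : Prop :=
  UpperSemicontinuous g ∧ Function.Periodic g (2 * Real.pi) ∧
    (∀ θ, 0 ≤ g θ ∧ g θ ≤ R₀) ∧ BoundedVariationOn g (Set.Icc 0 (2 * Real.pi))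

/-- `g⁻(θ) = liminf_{θ' → θ} g(θ')`. -/
def gminus (g : ℝ → ℝ) (θ : ℝ) : ℝ := Filter.liminf g (nhdsWithin θ {θ}ᶜ)

/-- `g⁺(θ) = limsup_{θ' → θ} g(θ')`. -/
def gplus (g : ℝ → ℝ) (θ : ℝ) : ℝ := Filter.limsup g (nhdsWithin θ {θ}ᶜ)

/-- The "regular" part `Γ_g` of the extended graph of `g`. -/
def GammaSet (g : ℝ → ℝ) : Set (EuclideanSpace ℝ (Fin 2)) :=
  {p | ∃ θ ρ : ℝ, gminus g θ ≤ ρ ∧ ρ ≤ gplus g θ ∧ p = ρ • sig θ}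

/-- The set of cracks `Σ_g`. -/
def SigmaSet (g : ℝ → ℝ) : Set (EuclideanSpace ℝ (Fin 2)) :=
  closure {p | ∃ θ ρ : ℝ, gplus g θ < ρ ∧ ρ < g θ ∧ p = ρ • sig θ}

/-- The starshaped set `F_g` with radial function `g`. -/
def FSet (g : ℝ → ℝ) : Set (EuclideanSpace ℝ (Fin 2)) :=
  {p | ∃ θ ρ : ℝ, 0 ≤ ρ ∧ ρ ≤ g θ ∧ p = ρ • sig θ}

/-- `F_g` satisfies the uniform exterior ball condition with radius `rbar`. -/
def ExtBallCond (g : ℝ → ℝ) (rbar : ℝ) : Prop :=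
  ∀ z ∈ GammaSet g ∪ SigmaSet g, ∀ r : ℝ, 0 < r → r < rbar →
    ∃ z₀ : EuclideanSpace ℝ (Fin 2),
      Metric.ball z₀ r ⊆ (FSet g)ᶜ ∧
      Metric.sphere z₀ r ∩ (GammaSet g ∪ SigmaSet g) = {z}

lemma norm_sig (θ : ℝ) : ‖sig θ‖ = 1 := by
  simp [sig, EuclideanSpace.norm_eq, Fin.sum_univ_two]

lemma sig_add_int_mul_two_pi (θ : ℝ) (k : ℤ) : sig (θ + k * (2 * Real.pi)) = sig θ := by
  simp [sig, Real.cos_add_int_mul_two_pi, Real.sin_add_int_mul_two_pi]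

lemma norm_sig_sub_sig (a b : ℝ) : ‖sig a - sig b‖ = 2 * |Real.sin ((a - b) / 2)| := by
  have hsq : ‖sig a - sig b‖ ^ 2 = (2 * |Real.sin ((a - b) / 2)|) ^ 2 := by
    have hcos : Real.cos (a - b) = 1 - 2 * Real.sin ((a - b) / 2) ^ 2 := by
      have := Real.cos_two_mul ((a - b) / 2)
      rw [show 2 * ((a - b) / 2) = a - b by ring] at this
      linarith [Real.sin_sq_add_cos_sq ((a - b) / 2)]
    rw [mul_pow, sq_abs, EuclideanSpace.real_norm_sq_eq, Fin.sum_univ_two]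
    simp only [sig, PiLp.sub_apply, PiLp.continuousLinearEquiv_symm_apply, Matrix.cons_val_zero,
      Matrix.cons_val_one]
    rw [Real.cos_sub] at hcos
    nlinarith [Real.sin_sq_add_cos_sq a, Real.sin_sq_add_cos_sq b]
  exact (sq_eq_sq₀ (norm_nonneg _) (by positivity)).1 hsq

lemma norm_sig_sub_sig_le (a b : ℝ) : ‖sig a - sig b‖ ≤ |a - b| := by
  rw [norm_sig_sub_sig]
  have := Real.abs_sin_le_abs (x := (a - b) / 2)
  rw [abs_div, abs_two] at this
  linarith

lemma mul_abs_sub_le_norm_sig_sub_sig {a b : ℝ} (hab : |a - b| ≤ Real.pi) :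
    2 / Real.pi * |a - b| ≤ ‖sig a - sig b‖ := by
  rw [norm_sig_sub_sig]
  have hle : |(a - b) / 2| ≤ Real.pi / 2 := by
    rw [abs_div, abs_two]
    linarith
  have h₁ := Real.mul_le_sin (abs_nonneg ((a - b) / 2)) hle
  have h₂ : Real.sin |(a - b) / 2| ≤ |Real.sin ((a - b) / 2)| := by
    rcases abs_cases ((a - b) / 2) with ⟨h, _⟩ | ⟨h, _⟩ <;> rw [h]
    · exact le_abs_self _
    · rw [Real.sin_neg]
      exact neg_le_abs _
  have h₃ : 2 / Real.pi * |(a - b) / 2| = 2 / Real.pi * |a - b| / 2 := by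
    rw [abs_div, abs_two]
    ring
  linarith

/-- Polar coordinates, with the angle chosen close to a prescribed `α`. -/
lemma exists_polar (c : EuclideanSpace ℝ (Fin 2)) (α : ℝ) :
    ∃ R β : ℝ, 0 ≤ R ∧ c = R • sig β ∧
      ∀ a : ℝ, 0 ≤ a → R * |α - β| ≤ Real.pi * ‖c - a • sig α‖ := by
  set w : ℂ := ⟨c 0, c 1⟩ with hw
  have hc : c = ‖w‖ • sig w.arg := by
    ext i
    fin_cases i
    · simp [sig, Complex.norm_mul_cos_arg, hw]
    · simp [sig, Complex.norm_mul_sin_arg, hw]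
  obtain ⟨k, hk, -⟩ := existsUnique_add_zsmul_mem_Ico
    (mul_pos two_pos Real.pi_pos) w.arg (α - Real.pi)
  rw [zsmul_eq_mul] at hk
  rw [← sig_add_int_mul_two_pi w.arg k] at hc
  set β := w.arg + k * (2 * Real.pi)
  refine ⟨‖w‖, β, norm_nonneg _, hc, fun a ha => ?_⟩
  have hαβ : |α - β| ≤ Real.pi := abs_le.2 ⟨by linarith [hk.2], by linarith [hk.1]⟩
  have h₁ := mul_abs_sub_le_norm_sig_sub_sig hαβ
  have hnc : ‖c‖ = ‖w‖ := by rw [hc, norm_smul, norm_sig]; simp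
  have h₂ : |a - ‖w‖| ≤ ‖c - a • sig α‖ := by
    have := abs_norm_sub_norm_le c (a • sig α)
    rwa [hnc, norm_smul, norm_sig, mul_one, Real.norm_of_nonneg ha, abs_sub_comm] at this
  have h₃ : ‖w‖ * ‖sig α - sig β‖ ≤ ‖c - a • sig α‖ + |a - ‖w‖| := by
    have h₄ : ‖w‖ * ‖sig α - sig β‖ = ‖(c - a • sig α) + (a - ‖w‖) • sig α‖ := by
      rw [← norm_neg ((c - a • sig α) + _), ← norm_norm w, ← norm_smul, norm_norm]
      congr 1
      generalize ‖w‖ = R at hc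
      rw [hc]
      module
    rw [h₄]
    refine (norm_add_le _ _).trans_eq ?_
    rw [norm_smul, norm_sig, mul_one, Real.norm_eq_abs]
  have h₅ : ‖w‖ * (2 / Real.pi * |α - β|) ≤ 2 * ‖c - a • sig α‖ :=
    (mul_le_mul_of_nonneg_left h₁ (norm_nonneg _)).trans (by linarith)
  have h₆ : ‖w‖ * |α - β| = Real.pi / 2 * (‖w‖ * (2 / Real.pi * |α - β|)) := by
    field_simp
  rw [h₆]
  nlinarith [Real.pi_pos]

/-- The open ball of radius `r` touching `g θ • sig θ` in direction `u` does not meet the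
subgraph of `g`. -/
def OuterBall (g : ℝ → ℝ) (r θ : ℝ) (u : EuclideanSpace ℝ (Fin 2)) : Prop :=
  ‖u‖ = 1 ∧ ∀ φ ρ : ℝ, 0 ≤ ρ → ‖ρ • sig φ - g θ • sig θ - r • u‖ < r → g φ < ρ

lemma smul_sig_mem_GammaSet_union_SigmaSet {R₀ : ℝ} {g : ℝ → ℝ} (hg : BVsharp R₀ g) (θ : ℝ) :
    g θ • sig θ ∈ GammaSet g ∪ SigmaSet g := by
  obtain ⟨husc, -, hbd, -⟩ := hg
  have hab : IsBoundedUnder (· ≤ ·) (nhdsWithin θ {θ}ᶜ) g :=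
    isBoundedUnder_of ⟨R₀, fun x => (hbd x).2⟩
  have hbe : IsBoundedUnder (· ≥ ·) (nhdsWithin θ {θ}ᶜ) g :=
    isBoundedUnder_of ⟨0, fun x => (hbd x).1⟩
  have hle : gplus g θ ≤ g θ := by
    refine le_of_forall_pos_le_add fun ε hε => ?_
    refine limsup_le_of_le hbe.isCoboundedUnder_le ?_
    have := husc θ (g θ + ε) (by linarith)
    exact (this.filter_mono nhdsWithin_le_nhds).mono fun x hx => le_of_lt hx
  rcases hle.eq_or_lt with heq | hlt
  · exact Or.inl ⟨θ, g θ, heq ▸ liminf_le_limsup hab hbe, heq.ge, rfl⟩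
  · right
    have hcont : ContinuousWithinAt (fun ρ : ℝ => ρ • sig θ) (Ioo (gplus g θ) (g θ)) (g θ) := by
      fun_prop
    refine closure_mono ?_ (hcont.mem_closure_image ?_)
    · rintro _ ⟨ρ, hρ, rfl⟩
      exact ⟨θ, ρ, hρ.1, hρ.2, rfl⟩
    · rw [closure_Ioo hlt.ne]
      exact right_mem_Icc.2 hlt.le

lemma ExtBallCond.exists_outerBall {R₀ rbar r : ℝ} {g : ℝ → ℝ} (hg : BVsharp R₀ g)
    (hball : ExtBallCond g rbar) (hr : 0 < r) (hr' : r < rbar) (θ : ℝ) :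
    ∃ u, OuterBall g r θ u := by
  obtain ⟨z₀, hsub, hsph⟩ :=
    hball _ (smul_sig_mem_GammaSet_union_SigmaSet hg θ) r hr hr'
  have hz : g θ • sig θ ∈ sphere z₀ r := by
    have : g θ • sig θ ∈ sphere z₀ r ∩ (GammaSet g ∪ SigmaSet g) := by
      rw [hsph]
      rfl
    exact this.1
  have hz' : ‖z₀ - g θ • sig θ‖ = r := by
    rwa [mem_sphere, dist_comm, dist_eq_norm] at hz
  refine ⟨r⁻¹ • (z₀ - g θ • sig θ), ?_, fun φ ρ hρ hlt => ?_⟩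
  · rw [norm_smul, hz', Real.norm_of_nonneg (by positivity), inv_mul_cancel₀ hr.ne']
  · by_contra! hle
    rw [smul_inv_smul₀ hr.ne', sub_sub_sub_cancel_right] at hlt
    exact hsub (mem_ball_iff_norm.2 hlt) ⟨φ, ρ, hρ, hle, rfl⟩

/-- An outer ball at a point well below the graph of `h` forces `g` to stay well below `h` on an
angular interval of definite length. -/
lemma exists_gap {R₀ K m r ε : ℝ} (hR₀ : 0 < R₀) (hK : 0 ≤ K) (hm : 0 < m) (hr : 0 < r)
    (hε : 0 < ε) (hεm : ε ≤ m) {h : ℝ → ℝ} (hLip : ∀ a b, |h a - h b| ≤ K * |a - b|)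
    (hmh : ∀ a, m ≤ h a) :
    ∃ δ, 0 < δ ∧ δ ≤ Real.pi ∧ ∀ (g : ℝ → ℝ) (θ : ℝ) (u : EuclideanSpace ℝ (Fin 2)),
      0 ≤ g θ → g θ ≤ R₀ → OuterBall g r θ u → g θ < h θ - ε →
        ∃ β, ∀ φ, |φ - β| < δ → g φ + ε / 2 ≤ h φ := by
  have hπ := Real.pi_pos
  set C := 1 + K * (2 * Real.pi / m + 1 / R₀) with hC
  have hCpos : 0 < C := by positivity
  set ρ := min r (ε / 2 / C)
  have hρ : 0 < ρ := lt_min hr (by positivity)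
  have hρC : ρ * C ≤ ε / 2 := by
    rw [← le_div_iff₀ hCpos]
    exact min_le_right _ _
  refine ⟨min Real.pi (ρ / (R₀ + ρ)), lt_min hπ (by positivity), min_le_left _ _, ?_⟩
  intro g θ u hg0 hgR hu hgθ
  obtain ⟨R, β, hR, hc, hpol⟩ := exists_polar (g θ • sig θ + ρ • u) θ
  have hnorm : ‖ρ • u‖ = ρ := by rw [norm_smul, hu.1, mul_one, Real.norm_of_nonneg hρ.le]
  have hβ : R * |θ - β| ≤ Real.pi * ρ := by
    have := hpol (g θ) hg0
    rwa [add_sub_cancel_left, hnorm] at this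
  have hRle : R ≤ g θ + ρ := by
    have := norm_add_le (g θ • sig θ) (ρ • u)
    rwa [hc, hnorm, norm_smul, norm_smul, norm_sig, norm_sig, mul_one, mul_one,
      Real.norm_of_nonneg hR, Real.norm_of_nonneg hg0] at this
  refine ⟨β, fun φ hφ => ?_⟩
  have hφ' : (R₀ + ρ) * |φ - β| < ρ := by
    have := (lt_div_iff₀ (by positivity)).1 (hφ.trans_le (min_le_right _ _))
    linarith
  have hφR : R * |φ - β| < ρ :=
    (mul_le_mul_of_nonneg_right (by linarith) (abs_nonneg _)).trans_lt hφ'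
  have hlt : g φ < R := by
    refine hu.2 φ R hR ?_
    have heq : R • sig φ - g θ • sig θ - r • u = R • (sig φ - sig β) + (ρ - r) • u := by
      have : R • sig β = g θ • sig θ + ρ • u := hc.symm
      rw [smul_sub, this]
      module
    have hrρ : ρ ≤ r := min_le_left _ _
    rw [heq]
    refine (norm_add_le _ _).trans_lt ?_
    rw [norm_smul, norm_smul, hu.1, Real.norm_of_nonneg hR, Real.norm_of_nonpos (by linarith)]
    have := mul_le_mul_of_nonneg_left (norm_sig_sub_sig_le φ β) hR
    linarith
  rcases le_or_gt R (m / 2) with hRm | hRm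
  · linarith [hmh φ]
  · have h₁ : |θ - β| ≤ 2 * Real.pi / m * ρ := by
      rw [div_mul_eq_mul_div, le_div_iff₀ hm]
      nlinarith [abs_nonneg (θ - β)]
    have h₂ : |φ - β| ≤ 1 / R₀ * ρ := by
      rw [div_mul_eq_mul_div, le_div_iff₀ hR₀]
      nlinarith [abs_nonneg (φ - β)]
    have h₃ : |θ - φ| ≤ 2 * Real.pi / m * ρ + 1 / R₀ * ρ := by
      have := abs_sub_le θ β φ
      rw [abs_sub_comm β φ] at this
      linarith
    have h₄ := (abs_le.1 ((hLip θ φ).trans (mul_le_mul_of_nonneg_left h₃ hK))).2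
    have h₅ : ρ * C = ρ + K * (2 * Real.pi / m * ρ + 1 / R₀ * ρ) := by rw [hC]; ring
    linarith

lemma le_integral_of_gap {f : ℝ → ℝ} (hf : Function.Periodic f (2 * Real.pi))
    (hint : ∀ a b, IntervalIntegrable f volume a b) (hf0 : ∀ x, 0 ≤ f x) {β δ ε : ℝ}
    (hδ : 0 < δ) (hδπ : δ ≤ Real.pi) (hgap : ∀ x, |x - β| < δ → ε ≤ f x) :
    δ * ε ≤ ∫ x in (0 : ℝ)..(2 * Real.pi), f x := by
  have h₁ := hf.intervalIntegral_add_eq 0 β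
  rw [zero_add] at h₁
  rw [h₁]
  calc δ * ε = ∫ _ in β..β + δ, ε := by simp
    _ ≤ ∫ x in β..β + δ, f x := by
      refine intervalIntegral.integral_mono_on_of_le_Ioo (by linarith) (by simp) (hint _ _) ?_
      intro x hx
      exact hgap x (abs_lt.2 ⟨by linarith [hx.1], by linarith [hx.2]⟩)
    _ ≤ _ := intervalIntegral.integral_mono_interval le_rfl (by linarith) (by linarith)
      (Eventually.of_forall hf0) (hint _ _)

/-- If `g` is Lipschitz up to a small error, its outer normals are uniformly transversal to the
angular direction. -/
lemma exists_le_inner {R₀ K m r : ℝ} (hR₀ : 0 < R₀) (hK : 0 ≤ K) (hm : 0 < m) (hr : 0 < r) :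
    ∃ s > 0, ∃ η > 0, ∀ g : ℝ → ℝ, (∀ a, m ≤ g a) → (∀ a, g a ≤ R₀) →
      (∀ a b, g a ≤ g b + K * |a - b| + η) → ∀ θ u, OuterBall g r θ u →
        s ≤ inner ℝ (g θ • sig θ) u := by
  have hπ := Real.pi_pos
  set C := 1 + K * (2 * Real.pi / m) with hC
  have hCpos : 0 < C := by positivity
  set s := m / 2 / C
  have hs : 0 < s := by positivity
  have hsC : s * C = m / 2 := div_mul_cancel₀ _ hCpos.ne'
  set t := min 1 (r * s / (R₀ + s) ^ 2)
  have ht : 0 < t := lt_min one_pos (by positivity)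
  have ht1 : t ≤ 1 := min_le_left _ _
  have htM : t * (R₀ + s) ^ 2 ≤ r * s := by
    rw [← le_div_iff₀ (by positivity)]
    exact min_le_right _ _
  refine ⟨s / 2, by positivity, t * (m / 2), by positivity, ?_⟩
  intro g hmg hgR hLip θ u hu
  have hgθ := hmg θ
  set z := g θ • sig θ with hz
  obtain ⟨b, β, hb, hq, hpol⟩ := exists_polar ((1 - t) • z + (t * s) • u) θ
  have hnorm : ‖(t * s) • u‖ = t * s := by
    rw [norm_smul, hu.1, mul_one, Real.norm_of_nonneg (by positivity)]
  have hnz : ‖z‖ = g θ := by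
    rw [hz, norm_smul, norm_sig, mul_one, Real.norm_of_nonneg (by linarith)]
  have hβ : b * |θ - β| ≤ Real.pi * (t * s) := by
    have := hpol ((1 - t) * g θ) (mul_nonneg (by linarith) (by linarith))
    rwa [mul_smul (1 - t), ← hz, add_sub_cancel_left, hnorm] at this
  have hble : b ≤ (1 - t) * g θ + t * s := by
    have := norm_add_le ((1 - t) • z) ((t * s) • u)
    rwa [hq, hnorm, norm_smul, norm_smul, norm_sig, mul_one, hnz,
      Real.norm_of_nonneg hb, Real.norm_of_nonneg (by linarith : 0 ≤ 1 - t)] at this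
  have hbg : b ≤ g β := by
    rcases le_or_gt b (m / 2) with hbm | hbm
    · linarith [hmg β]
    · have h₁ : |θ - β| ≤ 2 * Real.pi / m * (t * s) := by
        rw [div_mul_eq_mul_div, le_div_iff₀ hm]
        nlinarith [abs_nonneg (θ - β)]
      have h₂ := mul_le_mul_of_nonneg_left h₁ hK
      have h₃ := hLip θ β
      have h₄ : t * s + K * (2 * Real.pi / m * (t * s)) = t * (m / 2) := by
        rw [← hsC, hC]; ring
      have h₅ : t * m ≤ t * g θ := mul_le_mul_of_nonneg_left hgθ ht.le
      linarith
  have hfar : r ≤ ‖t • (s • u - z) - r • u‖ := by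
    by_contra! hlt
    refine absurd (hu.2 β b hb ?_) hbg.not_gt
    rw [← hq, ← hz]
    rwa [show (1 - t) • z + (t * s) • u - z - r • u = t • (s • u - z) - r • u by module]
  have hsq : r ^ 2 ≤ ‖t • (s • u - z) - r • u‖ ^ 2 := by gcongr
  have huu : inner ℝ u u = (1 : ℝ) := by rw [real_inner_self_eq_norm_sq, hu.1, one_pow]
  have hM : ‖s • u - z‖ ≤ R₀ + s := by
    refine (norm_sub_le _ _).trans ?_
    rw [norm_smul, hu.1, mul_one, Real.norm_of_nonneg hs.le, hnz]
    linarith [hgR θ]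
  have hM2 : ‖s • u - z‖ ^ 2 ≤ (R₀ + s) ^ 2 := by gcongr
  rw [norm_sub_sq_real, norm_smul, norm_smul, hu.1, inner_smul_left, inner_smul_right,
    inner_sub_left, inner_smul_left, huu, Real.norm_of_nonneg ht.le,
    Real.norm_of_nonneg hr.le] at hsq
  simp only [conj_trivial, mul_one, mul_pow] at hsq
  have h₁ : t * (2 * r * (s - inner ℝ z u)) ≤ t * (t * ‖s • u - z‖ ^ 2) := by nlinarith
  have h₂ := le_of_mul_le_mul_left h₁ ht
  have h₃ : t * ‖s • u - z‖ ^ 2 ≤ r * s := (mul_le_mul_of_nonneg_left hM2 ht.le).trans htM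
  have h₄ : r * (2 * (s - inner ℝ z u)) ≤ r * s := by linarith
  linarith [le_of_mul_le_mul_left h₄ hr]

lemma exists_local_lipschitz {R₀ r s : ℝ} (hR₀ : 0 < R₀) (hr : 0 < r) (hs : 0 < s) :
    ∃ L > 0, ∃ δ > 0, ∀ (g : ℝ → ℝ) (θ : ℝ) (u : EuclideanSpace ℝ (Fin 2)),
      0 ≤ g θ → g θ ≤ R₀ → OuterBall g r θ u → s ≤ inner ℝ (g θ • sig θ) u →
        ∀ φ, |φ - θ| < δ → g φ ≤ g θ + L * |φ - θ| := by
  set c := s / R₀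
  have hc : 0 < c := by positivity
  set L := (R₀ + 2) / c
  have hL : 0 < L := by positivity
  have hLc : L * c = R₀ + 2 := div_mul_cancel₀ _ hc.ne'
  set M := L + R₀ + 1
  have hM : 0 < M := by positivity
  refine ⟨L, hL, min (1 / L) (2 * r / M ^ 2), lt_min (by positivity) (by positivity), ?_⟩
  intro g θ u hg0 hgR hu hin φ hφ
  rcases eq_or_ne φ θ with rfl | hne
  · simp
  set τ := |φ - θ|
  have hτ : 0 < τ := abs_pos.2 (sub_ne_zero.2 hne)
  have hLτ : τ * L < 1 := (lt_div_iff₀ hL).1 (hφ.trans_le (min_le_left _ _))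
  have hMτ : τ * M ^ 2 < 2 * r :=
    (lt_div_iff₀ (by positivity)).1 (hφ.trans_le (min_le_right _ _))
  have hsu : c ≤ inner ℝ (sig θ) u := by
    rw [inner_smul_left, conj_trivial] at hin
    have hpos : 0 < inner ℝ (sig θ) u := by
      by_contra! hneg
      nlinarith
    rw [div_le_iff₀ hR₀]
    nlinarith
  refine le_of_lt (hu.2 φ _ (by positivity) ?_)
  set v := (g θ + L * τ) • (sig φ - sig θ)
  have hv : ‖v‖ ≤ (R₀ + 1) * τ := by
    rw [norm_smul, Real.norm_of_nonneg (by positivity)]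
    exact mul_le_mul (by linarith) (norm_sig_sub_sig_le φ θ) (norm_nonneg _) (by positivity)
  set w := (L * τ) • sig θ + v with hw
  have heq : (g θ + L * τ) • sig φ - g θ • sig θ - r • u = w - r • u := by
    rw [hw]
    module
  have hwn : ‖w‖ ≤ τ * M := by
    refine (norm_add_le _ _).trans ?_
    rw [norm_smul, norm_sig, mul_one, Real.norm_of_nonneg (by positivity)]
    linarith
  have hwu : τ ≤ inner ℝ w u := by
    have h₁ : -((R₀ + 1) * τ) ≤ inner ℝ v u := by
      have := (abs_le.1 (abs_real_inner_le_norm v u)).1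
      rw [hu.1, mul_one] at this
      linarith
    rw [hw, inner_add_left, inner_smul_left, conj_trivial]
    have h₂ : τ * (L * c) ≤ L * τ * inner ℝ (sig θ) u := by
      have := mul_le_mul_of_nonneg_left hsu (by positivity : 0 ≤ L * τ)
      linarith
    rw [hLc] at h₂
    linarith
  rw [heq]
  refine lt_of_pow_lt_pow_left₀ 2 hr.le ?_
  rw [norm_sub_sq_real, inner_smul_right, norm_smul, hu.1, mul_one, Real.norm_of_nonneg hr.le]
  have h₁ : ‖w‖ ^ 2 ≤ (τ * M) ^ 2 := by gcongr
  have h₂ : (τ * M) ^ 2 < τ * (2 * r) := by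
    rw [show (τ * M) ^ 2 = τ * (τ * M ^ 2) by ring]
    exact mul_lt_mul_of_pos_left hMτ hτ
  have h₃ : r * τ ≤ r * inner ℝ w u := mul_le_mul_of_nonneg_left hwu hr.le
  linarith

lemma Function.Periodic.exists_pos_le {f : ℝ → ℝ} {T : ℝ} (hf : Function.Periodic f T)
    (hT : T ≠ 0) (hc : Continuous f) (hpos : ∀ x, 0 < f x) : ∃ m > 0, ∀ x, m ≤ f x := by
  obtain ⟨_, ⟨x₀, rfl⟩, hmin⟩ :=
    (hf.compact_of_continuous hT hc).exists_isLeast (range_nonempty f)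
  exact ⟨f x₀, hpos x₀, fun x => hmin ⟨x, rfl⟩⟩

lemma Function.Periodic.exists_lipschitz_of_contDiff {f : ℝ → ℝ} {T : ℝ}
    (hf : Function.Periodic f T) (hT : T ≠ 0) (hc : ContDiff ℝ 1 f) :
    ∃ K, 0 ≤ K ∧ ∀ a b, |f a - f b| ≤ K * |a - b| := by
  have hd : Function.Periodic (deriv f) T := fun x => by
    rw [← deriv_comp_add_const, funext hf]
  obtain ⟨K, hK⟩ := (hd.isBounded_of_continuous hT (hc.continuous_deriv le_rfl)).exists_norm_le
  refine ⟨K, (norm_nonneg _).trans (hK _ ⟨0, rfl⟩), fun a b => ?_⟩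
  exact convex_univ.norm_image_sub_le_of_norm_deriv_le
    (fun x _ => hc.differentiable one_ne_zero x) (fun x _ => hK _ ⟨x, rfl⟩)
    (mem_univ b) (mem_univ a)

theorem stmt0 (R₀ : ℝ) (hR₀ : 0 < R₀) (h : ℝ → ℝ)
    (hsm : ContDiff ℝ (⊤ : ℕ∞) h) (hper : Function.Periodic h (2 * Real.pi))
    (hpos : ∀ θ, 0 < h θ ∧ h θ < R₀)
    (rbar : ℝ) (hrbar : 0 < rbar)
    (g : ℕ → ℝ → ℝ) (hg : ∀ n, BVsharp R₀ (g n))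
    (hobst : ∀ n : ℕ, 0 < n → ∀ θ, g n θ ≤ h θ + 1 / (n : ℝ))
    (hball : ∀ n, ExtBallCond (g n) rbar)
    (hL1 : Tendsto (fun n => ∫ θ in (0:ℝ)..(2 * Real.pi), |g n θ - h θ|) atTop (nhds 0))
    (hlen : Tendsto (fun n => μH[1] (GammaSet (g n) ∪ SigmaSet (g n))) atTop
      (nhds (μH[1] (GammaSet h)))) :
    (∀ ε > 0, ∃ N : ℕ, ∀ n ≥ N, ∀ θ, |g n θ - h θ| ≤ ε) ∧
    (∃ L > 0, ∃ N : ℕ, ∀ n ≥ N, ∀ θ₁ θ₂ : ℝ, |g n θ₁ - g n θ₂| ≤ L * |θ₁ - θ₂|) := by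
  have hT : 2 * Real.pi ≠ 0 := by positivity
  have hcont : Continuous h := hsm.continuous
  obtain ⟨m, hm, hmh⟩ := hper.exists_pos_le hT hcont fun θ => (hpos θ).1
  obtain ⟨K, hK, hLip⟩ := hper.exists_lipschitz_of_contDiff hT (hsm.of_le (by simp))
  set r := rbar / 2
  have hr : 0 < r := by positivity
  have hout : ∀ n θ, ∃ u, OuterBall (g n) r θ u := fun n θ =>
    (hball n).exists_outerBall (hg n) hr (half_lt_self hrbar) θ
  have hg0 : ∀ n θ, 0 ≤ g n θ := fun n θ => ((hg n).2.2.1 θ).1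
  have hgR : ∀ n θ, g n θ ≤ R₀ := fun n θ => ((hg n).2.2.1 θ).2
  have hint : ∀ n a b, IntervalIntegrable (fun θ => |g n θ - h θ|) volume a b := by
    intro n a b
    refine (IntervalIntegrable.sub ?_ (hcont.intervalIntegrable a b)).abs
    refine (intervalIntegrable_const (c := R₀)).mono_fun
      (hg n).1.measurable.aestronglyMeasurable (Eventually.of_forall fun x => ?_)
    beta_reduce
    rw [Real.norm_of_nonneg (hg0 n x), Real.norm_of_nonneg hR₀.le]
    exact hgR n x
  have hlower : ∀ ε > 0, ∀ᶠ n in atTop, ∀ θ, h θ - ε ≤ g n θ := by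
    intro ε hε
    have hε' : 0 < min ε m := lt_min hε hm
    obtain ⟨δ, hδ, hδπ, hgap⟩ :=
      exists_gap hR₀ hK hm hr hε' (min_le_right _ _) hLip hmh
    filter_upwards [hL1.eventually_lt_const (by positivity : 0 < δ * (min ε m / 2))] with n hn θ
    by_contra! hlt
    obtain ⟨u, hu⟩ := hout n θ
    obtain ⟨β, hβ⟩ := hgap (g n) θ u (hg0 n θ) (hgR n θ) hu
      (by linarith [min_le_left ε m])
    refine absurd (le_integral_of_gap (β := β) (fun x => ?_) (hint n) (fun x => abs_nonneg _)
      hδ hδπ (fun x hx => ?_)) hn.not_ge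
    · simp only [(hg n).2.1 x, hper x]
    · rw [abs_sub_comm]
      exact le_trans (by linarith [hβ x hx]) (le_abs_self _)
  have hupper : ∀ ε > 0, ∀ᶠ n in atTop, ∀ θ, g n θ ≤ h θ + ε := by
    intro ε hε
    filter_upwards [eventually_gt_atTop 0,
      tendsto_one_div_atTop_nhds_zero_nat.eventually_lt_const hε] with n hn hnε θ
    linarith [hobst n hn θ]
  have hunif : ∀ ε > 0, ∀ᶠ n in atTop, ∀ θ, |g n θ - h θ| ≤ ε := by
    intro ε hε
    filter_upwards [hlower ε hε, hupper ε hε] with n h₁ h₂ θ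
    exact abs_le.2 ⟨by linarith [h₁ θ], by linarith [h₂ θ]⟩
  refine ⟨fun ε hε => eventually_atTop.1 (hunif ε hε), ?_⟩
  obtain ⟨s, hs, η, hη, hinner⟩ := exists_le_inner (m := m / 2) hR₀ hK (by positivity) hr
  obtain ⟨L, hL, δ, hδ, hloc⟩ := exists_local_lipschitz hR₀ hr hs
  refine ⟨max L (R₀ / δ), lt_max_of_lt_left hL, eventually_atTop.1 ?_⟩
  filter_upwards [hunif (min (η / 2) (m / 2)) (by positivity)] with n hn
  have hn₁ : ∀ θ, |g n θ - h θ| ≤ η / 2 := fun θ => (hn θ).trans (min_le_left _ _)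
  have hn₂ : ∀ θ, |g n θ - h θ| ≤ m / 2 := fun θ => (hn θ).trans (min_le_right _ _)
  have hone : ∀ θ φ, |φ - θ| < δ → g n φ ≤ g n θ + L * |φ - θ| := by
    intro θ φ hφ
    obtain ⟨u, hu⟩ := hout n θ
    refine hloc (g n) θ u (hg0 n θ) (hgR n θ) hu (hinner (g n) ?_ (hgR n) ?_ θ u hu) φ hφ
    · intro a
      linarith [(abs_le.1 (hn₂ a)).1, hmh a]
    · intro a b
      linarith [(abs_le.1 (hn₁ a)).2, (abs_le.1 (hn₁ b)).1, (abs_le.1 (hLip a b)).2]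
  intro θ₁ θ₂
  rcases lt_or_ge |θ₁ - θ₂| δ with hlt | hge
  · have h₁ := hone θ₂ θ₁ hlt
    have h₂ := hone θ₁ θ₂ (by rwa [abs_sub_comm])
    rw [abs_sub_comm θ₂ θ₁] at h₂
    refine le_trans ?_ (mul_le_mul_of_nonneg_right (le_max_left _ _) (abs_nonneg _))
    exact abs_le.2 ⟨by linarith, by linarith⟩
  · refine le_trans ?_ (mul_le_mul_of_nonneg_right (le_max_right _ _) (abs_nonneg _))
    have h₁ : R₀ ≤ R₀ / δ * |θ₁ - θ₂| := by
      rw [div_mul_eq_mul_div, le_div_iff₀ hδ]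
      exact mul_le_mul_of_nonneg_left hge hR₀.le
    refine le_trans (abs_le.2 ⟨?_, ?_⟩) h₁ <;>
      linarith [hg0 n θ₁, hg0 n θ₂, hgR n θ₁, hgR n θ₂]

end
end

section
/- Let c ≥ 0 and let gₙ : ℝ → ℝ and h : ℝ → ℝ be continuously differentiable functions such that for every n the function θ ↦ gₙ(θ) − c θ² is concave. If sup_ℝ |gₙ − h| → 0 as n → ∞, then gₙ' → h' uniformly on every compact subset of ℝ. -/
open Filter Set

/-- A concave function on `ℝ` lies below its tangent lines. -/
lemma ConcaveOn.le_tangent {f : ℝ → ℝ} {f' x : ℝ} (hf : ConcaveOn ℝ univ f)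
    (hd : HasDerivAt f f' x) (y : ℝ) : f y ≤ f x + f' * (y - x) := by
  rcases lt_trichotomy x y with hxy | rfl | hxy
  · have := hf.slope_le_of_hasDerivAt (mem_univ x) (mem_univ y) hxy hd
    rw [slope_def_field, div_le_iff₀ (by linarith)] at this
    linarith
  · simp
  · have := hf.le_slope_of_hasDerivAt (mem_univ y) (mem_univ x) hxy hd
    rw [slope_def_field, le_div_iff₀ (by linarith)] at this
    linarith

/-- A function whose difference with `c * θ ^ 2` is concave lies below its tangent parabolas. -/
lemma le_tangent_add_sq {f : ℝ → ℝ} {c f' x : ℝ}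
    (hf : ConcaveOn ℝ univ fun θ => f θ - c * θ ^ 2) (hd : HasDerivAt f f' x) (y : ℝ) :
    f y ≤ f x + f' * (y - x) + c * (y - x) ^ 2 := by
  have hq : HasDerivAt (fun θ : ℝ => f θ - c * θ ^ 2) (f' - c * (2 * x)) x := by
    simpa using hd.fun_sub ((hasDerivAt_pow 2 x).const_mul c)
  have := hf.le_tangent hq y
  linarith

theorem stmt3 (c : ℝ) (hc : 0 ≤ c) (g : ℕ → ℝ → ℝ) (h : ℝ → ℝ)
    (hg : ∀ n, ContDiff ℝ 1 (g n)) (hh : ContDiff ℝ 1 h)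
    (hconc : ∀ n, ConcaveOn ℝ Set.univ (fun θ => g n θ - c * θ ^ 2))
    (hunif : ∀ ε > 0, ∃ N : ℕ, ∀ n ≥ N, ∀ θ : ℝ, |g n θ - h θ| ≤ ε) :
    ∀ K : Set ℝ, IsCompact K →
      TendstoUniformlyOn (fun n => deriv (g n)) (deriv h) atTop K := by
  intro K hK
  rw [Metric.tendstoUniformlyOn_iff]
  intro ε hε
  obtain ⟨η, hη, hηK⟩ := Metric.mem_uniformity_dist.1 <|
    hK.uniformContinuousAt_of_continuousAt (deriv h)
      (fun x _ => (hh.continuous_deriv le_rfl).continuousAt)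
      (Metric.dist_mem_uniformity (show 0 < ε / 4 by positivity))
  have hdh : Differentiable ℝ h := hh.differentiable one_ne_zero
  obtain ⟨t, ht, htη, htc⟩ : ∃ t > 0, t < η ∧ c * t ≤ ε / 4 := by
    refine ⟨min (η / 2) (ε / (4 * (c + 1))), by positivity,
      (min_le_left _ _).trans_lt (by linarith), ?_⟩
    calc c * min (η / 2) (ε / (4 * (c + 1))) ≤ (c + 1) * (ε / (4 * (c + 1))) := by
          gcongr
          · linarith
          · exact min_le_right _ _
      _ = ε / 4 := by field_simp
  obtain ⟨N, hN⟩ := hunif (ε / 8 * t) (by positivity)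
  filter_upwards [eventually_ge_atTop N] with n hn x hx
  have hd : HasDerivAt (g n) (deriv (g n) x) x :=
    ((hg n).differentiable one_ne_zero x).hasDerivAt
  have hright := le_tangent_add_sq (hconc n) hd (x + t)
  have hleft := le_tangent_add_sq (hconc n) hd (x - t)
  obtain ⟨u, hu, hu'⟩ := exists_deriv_eq_slope h (show x < x + t by linarith)
    hdh.continuous.continuousOn hdh.differentiableOn
  obtain ⟨v, hv, hv'⟩ := exists_deriv_eq_slope h (show x - t < x by linarith)
    hdh.continuous.continuousOn hdh.differentiableOn
  rw [eq_div_iff (by linarith)] at hu' hv'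
  have hxu : dist (deriv h x) (deriv h u) < ε / 4 := hηK (a := x) (b := u)
    (by rw [Real.dist_eq, abs_lt]; constructor <;> linarith [hu.1, hu.2]) hx
  have hxv : dist (deriv h x) (deriv h v) < ε / 4 := hηK (a := x) (b := v)
    (by rw [Real.dist_eq, abs_lt]; constructor <;> linarith [hv.1, hv.2]) hx
  rw [Real.dist_eq, abs_lt] at hxu hxv ⊢
  have h₀ := abs_le.1 (hN n hn x)
  have h₁ := abs_le.1 (hN n hn (x + t))
  have h₂ := abs_le.1 (hN n hn (x - t))
  have hlow : deriv h u * t ≤ (deriv (g n) x + ε / 4 + c * t) * t := by linarith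
  have hupp : (deriv (g n) x - ε / 4 - c * t) * t ≤ deriv h v * t := by linarith
  have hlow := le_of_mul_le_mul_right hlow ht
  have hupp := le_of_mul_le_mul_right hupp ht
  constructor <;> linarith
end

section
/- Let K, r > 0. There exists a constant C > 0, depending only on K and r, with the following property: whenever g : ℝ → ℝ is continuously differentiable with |g'(θ)| ≤ K for all θ, and for every θ₀ ∈ ℝ there exists z₀ ∈ ℝ² with |z₀ − (θ₀, g(θ₀))| = r such that the open ball of radius r centered at z₀ is disjoint from the subgraph {(θ, ρ) ∈ ℝ² : ρ ≤ g(θ)}, then for all θ₀, θ ∈ ℝ one has g(θ) ≤ g(θ₀) + g'(θ₀)(θ − θ₀) + C (θ − θ₀)²; in particular, the function θ ↦ g(θ) − C θ² is concave. -/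
open Real Set Metric

noncomputable section

/-- The point of the Euclidean plane with coordinates `(a, b)`. -/
def pt (a b : ℝ) : EuclideanSpace ℝ (Fin 2) :=
  (EuclideanSpace.equiv (Fin 2) ℝ).symm ![a, b]

/-- The subgraph `{(θ, ρ) : ρ ≤ g(θ)}` of `g` in the Euclidean plane. -/
def Subgraph (g : ℝ → ℝ) : Set (EuclideanSpace ℝ (Fin 2)) :=
  {p | ∃ θ ρ : ℝ, ρ ≤ g θ ∧ p = pt θ ρ}

theorem dist_pt_sq (a b c d : ℝ) : dist (pt a b) (pt c d) ^ 2 = (a - c) ^ 2 + (b - d) ^ 2 := by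
  rw [EuclideanSpace.dist_eq, Real.sq_sqrt (by positivity)]
  simp [pt, Fin.sum_univ_two, Real.dist_eq, sq_abs]

theorem exists_eq_pt (z : EuclideanSpace ℝ (Fin 2)) : ∃ a b : ℝ, z = pt a b := by
  refine ⟨z 0, z 1, ?_⟩
  ext i
  fin_cases i <;> simp [pt]

theorem concaveOn_sub_mul_sq {g p : ℝ → ℝ} {C : ℝ}
    (h : ∀ x y : ℝ, g y ≤ g x + p x * (y - x) + C * (y - x) ^ 2) :
    ConcaveOn ℝ Set.univ (fun x => g x - C * x ^ 2) := by
  refine ⟨convex_univ, fun x _ y _ s t hs ht hst => ?_⟩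
  simp only [smul_eq_mul]
  set w := s * x + t * y with hw
  have hx := mul_le_mul_of_nonneg_left (h w x) hs
  have hy := mul_le_mul_of_nonneg_left (h w y) ht
  obtain rfl : t = 1 - s := by linarith
  rw [hw] at hx hy ⊢
  linarith

/-- An exterior tangent disc at a point of a graph has its centre above that point, on the normal
line to the graph. -/
theorem tangent_disc_center {g : ℝ → ℝ} {r x a b : ℝ} (hr : 0 < r)
    (hg : DifferentiableAt ℝ g x) (hxr : (x - a) ^ 2 + (g x - b) ^ 2 = r ^ 2)
    (hout : ∀ y ρ : ℝ, ρ ≤ g y → r ^ 2 ≤ (y - a) ^ 2 + (ρ - b) ^ 2) :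
    a - x = -(deriv g x * (b - g x)) ∧ 0 < b - g x := by
  have hmin : IsLocalMin (fun y => (y - a) ^ 2 + (g y - b) ^ 2) x :=
    Filter.Eventually.of_forall fun y => by
      simpa only [hxr] using hout y (g y) le_rfl
  have hd : HasDerivAt (fun y => (y - a) ^ 2 + (g y - b) ^ 2)
      (2 * (x - a) + 2 * (g x - b) * deriv g x) x := by
    refine ((((hasDerivAt_id x).sub_const a).pow 2).add
      ((hg.hasDerivAt.sub_const b).pow 2)).congr_deriv ?_
    simp
  have h0 := hmin.hasDerivAt_eq_zero hd
  have hu : a - x = -(deriv g x * (b - g x)) := by linarith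
  refine ⟨hu, ?_⟩
  by_contra! hv
  have h1 := hout x b (by linarith)
  have hv0 : b - g x = 0 := by
    have : (b - g x) ^ 2 ≤ 0 := by linarith
    exact pow_eq_zero_iff two_ne_zero |>.mp (le_antisymm this (sq_nonneg _))
  rw [hv0, mul_zero, neg_zero] at hu
  nlinarith

theorem le_quadratic_of_tangent_disc {g : ℝ → ℝ} {K r x a b : ℝ} (hK : 0 < K) (hr : 0 < r)
    (hg : Differentiable ℝ g) (hgK : ∀ y, |deriv g y| ≤ K)
    (hxr : (x - a) ^ 2 + (g x - b) ^ 2 = r ^ 2)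
    (hout : ∀ y ρ : ℝ, ρ ≤ g y → r ^ 2 ≤ (y - a) ^ 2 + (ρ - b) ^ 2) (y : ℝ) :
    g y ≤ g x + deriv g x * (y - x) + (1 + 9 * K ^ 2) * (1 + K) / r * (y - x) ^ 2 := by
  obtain ⟨hu, hv⟩ := tangent_disc_center hr (hg x) hxr hout
  set C := (1 + 9 * K ^ 2) * (1 + K) / r with hC
  have hCpos : 0 < C := by positivity
  have hCr : C * r = (1 + 9 * K ^ 2) * (1 + K) := by rw [hC]; field_simp
  have hpK := hgK x
  set p := deriv g x
  set v := b - g x with hvdef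
  clear_value v
  obtain rfl : a = x - p * v := by linarith
  obtain rfl : b = g x + v := by linarith
  have hlip : |g y - g x| ≤ K * |y - x| := by
    simpa using convex_univ.norm_image_sub_le_of_norm_deriv_le
      (fun z _ => hg z) (fun z _ => hgK z) (Set.mem_univ x) (Set.mem_univ y)
  have hp2 : p ^ 2 ≤ K ^ 2 := sq_le_sq' (abs_le.mp hpK).1 (abs_le.mp hpK).2
  have hvK : r ≤ v * (1 + K) := by
    refine le_of_sq_le_sq ?_ (by positivity)
    nlinarith [mul_le_mul_of_nonneg_left hp2 (sq_nonneg v), mul_pos hK (pow_pos hv 2)]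
  have hvC : 1 + 9 * K ^ 2 ≤ C * v := by
    have := mul_le_mul_of_nonneg_left hvK hCpos.le
    rw [hCr] at this
    refine le_of_mul_le_mul_right ?_ (by positivity : 0 < 1 + K)
    linarith
  set h := y - x with hh
  clear_value h
  obtain rfl : y = x + h := by linarith
  rcases le_or_gt (2 * K) (C * |h|) with hbig | hsmall
  · have h1 := (abs_le.mp hlip).2
    have h2 : -(K * |h|) ≤ p * h := by
      have := neg_abs_le (p * h)
      rw [abs_mul] at this
      nlinarith [mul_le_mul_of_nonneg_right hpK (abs_nonneg h)]
    have h3 := mul_le_mul_of_nonneg_right hbig (abs_nonneg h)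
    have h4 : C * |h| * |h| = C * h ^ 2 := by rw [mul_assoc, ← sq, sq_abs]
    linarith
  · by_contra! hlt
    have hne : h ≠ 0 := by
      intro h0
      simp [h0] at hlt
    have h1 := hout (x + h) _ hlt.le
    have h2 : |p + C * h| ≤ 3 * K := by
      refine (abs_add_le _ _).trans ?_
      rw [abs_mul, abs_of_pos hCpos]
      linarith
    have h3 : (p + C * h) ^ 2 ≤ (3 * K) ^ 2 := sq_le_sq' (abs_le.mp h2).1 (abs_le.mp h2).2
    have h4 : 0 ≤ h ^ 2 * (1 + (p + C * h) ^ 2 - 2 * (C * v)) := by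
      rw [← hxr] at h1
      linarith
    have h5 := nonneg_of_mul_nonneg_right h4 (by positivity)
    nlinarith [sq_nonneg K]

theorem stmt4 (K r : ℝ) (hK : 0 < K) (hr : 0 < r) :
    ∃ C > 0, ∀ g : ℝ → ℝ, ContDiff ℝ 1 g → (∀ θ, |deriv g θ| ≤ K) →
      (∀ θ₀ : ℝ, ∃ z₀ : EuclideanSpace ℝ (Fin 2),
        dist z₀ (pt θ₀ (g θ₀)) = r ∧ Metric.ball z₀ r ∩ Subgraph g = ∅) →
      (∀ θ₀ θ : ℝ, g θ ≤ g θ₀ + deriv g θ₀ * (θ - θ₀) + C * (θ - θ₀) ^ 2) ∧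
      ConcaveOn ℝ Set.univ (fun θ => g θ - C * θ ^ 2) := by
  refine ⟨(1 + 9 * K ^ 2) * (1 + K) / r, by positivity, fun g hg hgK hball => ?_⟩
  have hdiff : Differentiable ℝ g := hg.differentiable one_ne_zero
  have hquad : ∀ x y : ℝ,
      g y ≤ g x + deriv g x * (y - x) + (1 + 9 * K ^ 2) * (1 + K) / r * (y - x) ^ 2 := by
    intro x y
    obtain ⟨z, hz, hdisj⟩ := hball x
    obtain ⟨a, b, rfl⟩ := exists_eq_pt z
    refine le_quadratic_of_tangent_disc (a := a) (b := b) hK hr hdiff hgK ?_ ?_ y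
    · rw [← dist_pt_sq, dist_comm, hz]
    · intro w ρ hρ
      rw [← dist_pt_sq]
      refine pow_le_pow_left₀ hr.le (not_lt.mp fun hlt => ?_) 2
      have hmem : pt w ρ ∈ Metric.ball (pt a b) r ∩ Subgraph g := ⟨hlt, w, ρ, hρ, rfl⟩
      rwa [hdisj] at hmem
  exact ⟨hquad, concaveOn_sub_mul_sq hquad⟩

end
end

section
/- Let μ, λ, a, b ∈ ℝ and define u : ℝ² ∖ {0} → ℝ² by u(z) = (a/|z|²) z + b z. Then for every z ≠ 0, Q(E(u)(z)) = 2(μ + λ) b² + 2μ a² / |z|⁴, where Q(ξ) = μ ‖ξ‖² + (λ/2)(tr ξ)². -/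
noncomputable section

/-- Partial derivative in the first variable of a function of two real variables. -/
def pdx (f : ℝ → ℝ → ℝ) : ℝ → ℝ → ℝ := fun x y => deriv (fun t => f t y) x

/-- Partial derivative in the second variable of a function of two real variables. -/
def pdy (f : ℝ → ℝ → ℝ) : ℝ → ℝ → ℝ := fun x y => deriv (fun t => f x t) y

/-- Derivative of `a t / (t² + c) + b t`: the component of the field along the differentiated
variable. -/
lemma hasDerivAt_field_self (a b c t : ℝ) (h : t ^ 2 + c ≠ 0) :
    HasDerivAt (fun s => a * s / (s ^ 2 + c) + b * s) (a * (c - t ^ 2) / (t ^ 2 + c) ^ 2 + b) t := by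
  have hnum : HasDerivAt (fun s : ℝ => a * s) a t := by
    simpa using (hasDerivAt_id t).const_mul a
  have hlin : HasDerivAt (fun s : ℝ => b * s) b t := by
    simpa using (hasDerivAt_id t).const_mul b
  have hden : HasDerivAt (fun s : ℝ => s ^ 2 + c) (2 * t) t := by
    simpa using (hasDerivAt_pow 2 t).add_const c
  refine ((hnum.fun_div hden h).fun_add hlin).congr_deriv ?_
  ring

/-- Derivative of `k / (t² + c) + d`: the component of the field orthogonal to the differentiated
variable. -/
lemma hasDerivAt_field_orthogonal (k c d t : ℝ) (h : t ^ 2 + c ≠ 0) :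
    HasDerivAt (fun s => k / (s ^ 2 + c) + d) (-(2 * k * t) / (t ^ 2 + c) ^ 2) t := by
  have hden : HasDerivAt (fun s : ℝ => s ^ 2 + c) (2 * t) t := by
    simpa using (hasDerivAt_pow 2 t).add_const c
  refine (((hasDerivAt_const t k).fun_div hden h).add_const d).congr_deriv ?_
  ring

theorem stmt8 (μ lam a b : ℝ) (u1 u2 : ℝ → ℝ → ℝ)
    (hu1 : ∀ x y : ℝ, u1 x y = a * x / (x ^ 2 + y ^ 2) + b * x)
    (hu2 : ∀ x y : ℝ, u2 x y = a * y / (x ^ 2 + y ^ 2) + b * y) :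
    ∀ x y : ℝ, (x, y) ≠ ((0 : ℝ), (0 : ℝ)) →
      -- Q(E(u)) = μ‖E(u)‖² + (λ/2)(tr E(u))², with
      -- E(u)₁₁ = ∂ₓu₁, E(u)₂₂ = ∂_y u₂, E(u)₁₂ = E(u)₂₁ = ½(∂_y u₁ + ∂ₓ u₂)
      μ * ((pdx u1 x y) ^ 2 + 2 * ((pdy u1 x y + pdx u2 x y) / 2) ^ 2
            + (pdy u2 x y) ^ 2)
        + lam / 2 * (pdx u1 x y + pdy u2 x y) ^ 2
      = 2 * (μ + lam) * b ^ 2 + 2 * μ * a ^ 2 / (x ^ 2 + y ^ 2) ^ 2 := by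
  intro x y hxy
  have hr : x ^ 2 + y ^ 2 ≠ 0 := by
    intro h
    have hx : x = 0 := by nlinarith [sq_nonneg x, sq_nonneg y]
    have hy : y = 0 := by nlinarith [sq_nonneg x, sq_nonneg y]
    exact hxy (by rw [hx, hy])
  have hr' : y ^ 2 + x ^ 2 ≠ 0 := by rwa [add_comm]
  have h11 : pdx u1 x y = a * (y ^ 2 - x ^ 2) / (x ^ 2 + y ^ 2) ^ 2 + b := by
    simpa only [pdx, hu1] using (hasDerivAt_field_self a b (y ^ 2) x hr).deriv
  have h22 : pdy u2 x y = a * (x ^ 2 - y ^ 2) / (x ^ 2 + y ^ 2) ^ 2 + b := by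
    simpa only [pdy, hu2, add_comm (y ^ 2), add_comm (_ ^ 2) (x ^ 2)] using
      (hasDerivAt_field_self a b (x ^ 2) y hr').deriv
  have h12 : pdy u1 x y = -(2 * (a * x) * y) / (x ^ 2 + y ^ 2) ^ 2 := by
    simpa only [pdy, hu1, add_comm (_ ^ 2) (x ^ 2)] using
      (hasDerivAt_field_orthogonal (a * x) (x ^ 2) (b * x) y hr').deriv
  have h21 : pdx u2 x y = -(2 * (a * y) * x) / (x ^ 2 + y ^ 2) ^ 2 := by
    simpa only [pdx, hu2] using
      (hasDerivAt_field_orthogonal (a * y) (y ^ 2) (b * y) x hr).deriv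
  rw [h11, h22, h12, h21]
  field_simp
  ring

end
end

section
/- Let μ > 0, λ ∈ ℝ, b ∈ ℝ, r > 0, set a = ((μ + λ)/μ) r² b, and define u : ℝ² ∖ {0} → ℝ² by u(z) = (a/|z|²) z + b z. Then for every z with |z| = r, the stress tensor satisfies 2μ E(u)(z) + λ · tr(E(u)(z)) · I = 4 b (μ + λ) ( I − (z ⊗ z)/r² ); in particular, (2μ E(u)(z) + λ · tr(E(u)(z)) · I) z = 0, i.e., the zero-traction boundary condition ℂE(u)[ν] = 0 holds on the circle of radius r. -/
noncomputable section

lemma hasDerivAt_radial (a b x y : ℝ) (h : x ^ 2 + y ^ 2 ≠ 0) :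
    HasDerivAt (fun t => a * t / (t ^ 2 + y ^ 2) + b * t)
      (a * (y ^ 2 - x ^ 2) / (x ^ 2 + y ^ 2) ^ 2 + b) x := by
  have hden : HasDerivAt (fun t : ℝ => t ^ 2 + y ^ 2) (2 * x) x := by
    simpa using (hasDerivAt_pow 2 x).add_const (y ^ 2)
  refine ((((hasDerivAt_id' x).const_mul a).fun_div hden h).fun_add
    ((hasDerivAt_id' x).const_mul b)).congr_deriv ?_
  congr 1 <;> ring

lemma hasDerivAt_transverse (a b x y : ℝ) (h : x ^ 2 + y ^ 2 ≠ 0) :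
    HasDerivAt (fun t => a * y / (t ^ 2 + y ^ 2) + b * y)
      (-(2 * a * x * y) / (x ^ 2 + y ^ 2) ^ 2) x := by
  have hden : HasDerivAt (fun t : ℝ => t ^ 2 + y ^ 2) (2 * x) x := by
    simpa using (hasDerivAt_pow 2 x).add_const (y ^ 2)
  refine (((hasDerivAt_const x (a * y)).fun_div hden h).add_const (b * y)).congr_deriv ?_
  congr 1
  ring

theorem stmt9 (μ lam b r : ℝ) (hμ : 0 < μ) (hr : 0 < r)
    (a : ℝ) (ha : a = (μ + lam) / μ * r ^ 2 * b)
    (u1 u2 : ℝ → ℝ → ℝ)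
    (hu1 : ∀ x y : ℝ, u1 x y = a * x / (x ^ 2 + y ^ 2) + b * x)
    (hu2 : ∀ x y : ℝ, u2 x y = a * y / (x ^ 2 + y ^ 2) + b * y) :
    ∀ x y : ℝ, x ^ 2 + y ^ 2 = r ^ 2 →
      -- the stress tensor ℂE(u) = 2μE(u) + λ tr(E(u)) I equals 4b(μ+λ)(I − z⊗z/r²):
      (2 * μ * pdx u1 x y + lam * (pdx u1 x y + pdy u2 x y)
          = 4 * b * (μ + lam) * (1 - x ^ 2 / r ^ 2)) ∧
      (2 * μ * ((pdy u1 x y + pdx u2 x y) / 2)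
          = 4 * b * (μ + lam) * (-(x * y) / r ^ 2)) ∧
      (2 * μ * pdy u2 x y + lam * (pdx u1 x y + pdy u2 x y)
          = 4 * b * (μ + lam) * (1 - y ^ 2 / r ^ 2)) ∧
      -- in particular the zero-traction condition ℂE(u)[ν] = 0 holds on {|z| = r}:
      ((2 * μ * pdx u1 x y + lam * (pdx u1 x y + pdy u2 x y)) * x
          + (2 * μ * ((pdy u1 x y + pdx u2 x y) / 2)) * y = 0) ∧
      ((2 * μ * ((pdy u1 x y + pdx u2 x y) / 2)) * x
          + (2 * μ * pdy u2 x y + lam * (pdx u1 x y + pdy u2 x y)) * y = 0) := by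
  intro x y hxy
  have hr2 : r ^ 2 ≠ 0 := by positivity
  have hxy0 : x ^ 2 + y ^ 2 ≠ 0 := hxy ▸ hr2
  have hyx0 : y ^ 2 + x ^ 2 ≠ 0 := add_comm (x ^ 2) (y ^ 2) ▸ hxy0
  have h11 : pdx u1 x y = a * (y ^ 2 - x ^ 2) / (r ^ 2) ^ 2 + b := by
    simp only [pdx, hu1]
    rw [(hasDerivAt_radial a b x y hxy0).deriv, hxy]
  have h22 : pdy u2 x y = a * (x ^ 2 - y ^ 2) / (r ^ 2) ^ 2 + b := by
    simp only [pdy, hu2, add_comm (x ^ 2)]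
    rw [(hasDerivAt_radial a b y x hyx0).deriv, add_comm (y ^ 2), hxy]
  have h21 : pdx u2 x y = -(2 * a * x * y) / (r ^ 2) ^ 2 := by
    simp only [pdx, hu2]
    rw [(hasDerivAt_transverse a b x y hxy0).deriv, hxy]
  have h12 : pdy u1 x y = -(2 * a * y * x) / (r ^ 2) ^ 2 := by
    simp only [pdy, hu1, add_comm (x ^ 2)]
    rw [(hasDerivAt_transverse a b y x hyx0).deriv, add_comm (y ^ 2), hxy]
  have hy : y ^ 2 = r ^ 2 - x ^ 2 := by linarith
  have s11 : 2 * μ * pdx u1 x y + lam * (pdx u1 x y + pdy u2 x y)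
      = 4 * b * (μ + lam) * (1 - x ^ 2 / r ^ 2) := by
    rw [h11, h22, hy, ha]
    field_simp
    ring
  have s12 : 2 * μ * ((pdy u1 x y + pdx u2 x y) / 2)
      = 4 * b * (μ + lam) * (-(x * y) / r ^ 2) := by
    rw [h12, h21, ha]
    field_simp
    ring
  have s22 : 2 * μ * pdy u2 x y + lam * (pdx u1 x y + pdy u2 x y)
      = 4 * b * (μ + lam) * (1 - y ^ 2 / r ^ 2) := by
    rw [h11, h22, hy, ha]
    field_simp
    ring
  refine ⟨s11, s12, s22, ?_, ?_⟩
  · rw [s11, s12]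
    field_simp
    linear_combination -(4 * b * (μ + lam) * x) * hxy
  · rw [s12, s22]
    field_simp
    linear_combination -(4 * b * (μ + lam) * y) * hxy

end
end

section
/- Let H be a real inner product space and let h, g ∈ H with ‖h‖ = ‖g‖ = 1 and ‖g − h‖ < 2. For t ∈ [0,1] set γ(t) = h + t(g − h) and u(t) = γ(t)/‖γ(t)‖. Then for every t ∈ [0,1]: (i) ‖γ(t)‖² = 1 − t(1 − t)‖g − h‖² > 0; (ii) u is differentiable at t and ‖u'(t)‖² = ( ‖h − g‖² − ¼ ‖h − g‖⁴ ) / ‖γ(t)‖⁴; (iii) if moreover ‖h − g‖² ≤ 2, then ‖u'(t)‖² ≥ ½ ‖h − g‖². -/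
open Set

/-- The derivative of the radial projection of a path onto the unit sphere. -/
theorem hasDerivAt_inv_norm_smul_self {H : Type*} [NormedAddCommGroup H] [InnerProductSpace ℝ H]
    {f : ℝ → H} {f' : H} {t : ℝ} (hf : HasDerivAt f f' t) (h0 : f t ≠ 0) :
    HasDerivAt (fun s ↦ ‖f s‖⁻¹ • f s)
      (‖f t‖⁻¹ • f' - (inner ℝ (f t) f' / ‖f t‖ ^ 3) • f t) t := by
  have hn : ‖f t‖ ≠ 0 := norm_ne_zero_iff.mpr h0
  have hnorm : HasDerivAt (fun s ↦ ‖f s‖) (inner ℝ (f t) f' / ‖f t‖) t := by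
    have hs := hf.norm_sq.sqrt (pow_ne_zero 2 hn)
    simp only [Real.sqrt_sq (norm_nonneg _)] at hs
    convert hs using 1
    field_simp
  convert (hnorm.fun_inv hn).fun_smul hf using 1
  rw [sub_eq_add_neg, ← neg_smul]
  congr 2
  field_simp

theorem norm_sq_deriv_inv_norm_smul {H : Type*} [NormedAddCommGroup H] [InnerProductSpace ℝ H]
    {x : H} (v : H) (hx : x ≠ 0) :
    ‖‖x‖⁻¹ • v - (inner ℝ x v / ‖x‖ ^ 3) • x‖ ^ 2 =
      (‖x‖ ^ 2 * ‖v‖ ^ 2 - inner ℝ x v ^ 2) / ‖x‖ ^ 4 := by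
  have hn : ‖x‖ ≠ 0 := norm_ne_zero_iff.mpr hx
  rw [norm_sub_sq_real, norm_smul, norm_smul, real_inner_smul_left, real_inner_smul_right,
    real_inner_comm, mul_pow, mul_pow, Real.norm_eq_abs, Real.norm_eq_abs, sq_abs, sq_abs]
  field_simp
  ring

theorem stmt11 {H : Type*} [NormedAddCommGroup H] [InnerProductSpace ℝ H]
    (h g : H) (hh : ‖h‖ = 1) (hg : ‖g‖ = 1) (hgh : ‖g - h‖ < 2)
    (γ : ℝ → H) (hγ : ∀ t, γ t = h + t • (g - h))
    (u : ℝ → H) (hu : ∀ t, u t = ‖γ t‖⁻¹ • γ t) :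
    ∀ t ∈ Set.Icc (0:ℝ) 1,
      -- (i)
      (‖γ t‖ ^ 2 = 1 - t * (1 - t) * ‖g - h‖ ^ 2 ∧ 0 < ‖γ t‖) ∧
      -- (ii)
      (DifferentiableAt ℝ u t ∧
        ‖deriv u t‖ ^ 2 = (‖h - g‖ ^ 2 - 1 / 4 * ‖h - g‖ ^ 4) / ‖γ t‖ ^ 4) ∧
      -- (iii)
      (‖h - g‖ ^ 2 ≤ 2 → 1 / 2 * ‖h - g‖ ^ 2 ≤ ‖deriv u t‖ ^ 2) := by
  rintro t ⟨ht0, ht1⟩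
  rw [norm_sub_rev h g]
  set v := g - h with hv
  have hhv : inner ℝ h v = -(‖v‖ ^ 2 / 2) := by
    have hsq := norm_add_sq_real h v
    rw [hv, add_sub_cancel, ← hv, hh, hg] at hsq
    linarith
  have hinner : inner ℝ (γ t) v = (t - 1 / 2) * ‖v‖ ^ 2 := by
    rw [hγ, inner_add_left, real_inner_smul_left, hhv, real_inner_self_eq_norm_sq]
    ring
  have hnorm : ‖γ t‖ ^ 2 = 1 - t * (1 - t) * ‖v‖ ^ 2 := by
    rw [hγ, norm_add_sq_real, real_inner_smul_right, hhv, norm_smul, mul_pow, Real.norm_eq_abs,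
      sq_abs, hh]
    ring
  have hv4 : ‖v‖ ^ 2 < 4 := by nlinarith [norm_nonneg v]
  have hpos : 0 < ‖γ t‖ := by
    have : 0 < ‖γ t‖ ^ 2 := by
      rw [hnorm]
      nlinarith [mul_nonneg (sq_nonneg (t - 1 / 2)) (sq_nonneg ‖v‖)]
    exact lt_of_pow_lt_pow_left₀ 2 (norm_nonneg _) (by simpa only [zero_pow two_ne_zero] using this)
  have hne : γ t ≠ 0 := norm_pos_iff.mp hpos
  have hγ' : HasDerivAt γ v t := by
    rw [funext hγ]
    simpa using ((hasDerivAt_id t).smul_const v).const_add h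
  have hu' := hasDerivAt_inv_norm_smul_self hγ' hne
  rw [← funext hu] at hu'
  have hderiv : ‖deriv u t‖ ^ 2 = (‖v‖ ^ 2 - 1 / 4 * ‖v‖ ^ 4) / ‖γ t‖ ^ 4 := by
    rw [hu'.deriv, norm_sq_deriv_inv_norm_smul v hne, hinner, hnorm]
    ring
  refine ⟨⟨hnorm, hpos⟩, ⟨hu'.differentiableAt, hderiv⟩, fun hv2 ↦ ?_⟩
  have hle : ‖γ t‖ ^ 2 ≤ 1 := by
    rw [hnorm]
    have := mul_nonneg (mul_nonneg ht0 (sub_nonneg.mpr ht1)) (sq_nonneg ‖v‖)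
    linarith
  have hle4 : ‖γ t‖ ^ 4 ≤ 1 := by nlinarith [sq_nonneg ‖γ t‖]
  rw [hderiv, le_div_iff₀ (by positivity)]
  nlinarith [mul_nonneg (sq_nonneg ‖v‖) (sub_nonneg.mpr hle4),
    mul_nonneg (sq_nonneg ‖v‖) (sub_nonneg.mpr hv2)]
end

section
/- Let H : ℝ × ℝ → ℝ be twice continuously differentiable with H(s, θ + 2π) = H(s, θ) and H(s, θ) > 0 for all (s, θ). Then for every s, d/ds ∫₀^{2π} √( H(s,θ)² + (∂_θ H(s,θ))² ) dθ = ∫₀^{2π} ∂_s H(s,θ) · H(s,θ) · k_s(θ) dθ, where k_s(θ) = ( H² + 2(∂_θ H)² − H ∂²_θ H )(s,θ) / ( H² + (∂_θ H)² )^{3/2}(s,θ). In other words, the first variation of the length of the polar graph θ ↦ H(s,θ)σ(θ) equals the integral of the normal velocity against the curvature. -/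
open Real intervalIntegral

theorem hasDerivAt_intervalIntegral_of_continuous {G D : ℝ → ℝ → ℝ} (a b : ℝ)
    (hG : ∀ t, Continuous (G t)) (hD : Continuous fun p : ℝ × ℝ => D p.1 p.2)
    (hGD : ∀ t θ, HasDerivAt (fun t => G t θ) (D t θ) t) (s : ℝ) :
    HasDerivAt (fun t => ∫ θ in a..b, G t θ) (∫ θ in a..b, D s θ) s := by
  obtain ⟨C, hC⟩ := ((isCompact_closedBall s 1).prod
    (isCompact_uIcc (a := a) (b := b))).exists_bound_of_continuousOn hD.continuousOn
  refine (hasDerivAt_integral_of_dominated_loc_of_deriv_le (bound := fun _ => C)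
    (Metric.closedBall_mem_nhds s one_pos)
    (Filter.Eventually.of_forall fun t => (hG t).aestronglyMeasurable)
    ((hG s).intervalIntegrable a b) ?_ ?_ intervalIntegrable_const ?_).2
  · exact (hD.comp (Continuous.prodMk_right s)).aestronglyMeasurable
  · exact .of_forall fun θ hθ t ht => hC (t, θ) ⟨ht, Set.uIoc_subset_uIcc hθ⟩
  · exact .of_forall fun θ _ t _ => hGD t θ

theorem hasDerivAt_fst_of_differentiable {f : ℝ × ℝ → ℝ} (hf : Differentiable ℝ f) (t θ : ℝ) :
    HasDerivAt (fun t => f (t, θ)) (fderiv ℝ f (t, θ) (1, 0)) t :=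
  (hf (t, θ)).hasFDerivAt.comp_hasDerivAt t ((hasDerivAt_id t).prodMk (hasDerivAt_const t θ))

theorem hasDerivAt_snd_of_differentiable {f : ℝ × ℝ → ℝ} (hf : Differentiable ℝ f) (t θ : ℝ) :
    HasDerivAt (fun θ => f (t, θ)) (fderiv ℝ f (t, θ) (0, 1)) θ :=
  (hf (t, θ)).hasFDerivAt.comp_hasDerivAt θ ((hasDerivAt_const θ t).prodMk (hasDerivAt_id θ))

theorem fderiv_fderiv_apply_comm {f : ℝ × ℝ → ℝ} (hf : ContDiff ℝ 2 f) (p v w : ℝ × ℝ) :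
    fderiv ℝ (fun q => fderiv ℝ f q v) p w = fderiv ℝ (fun q => fderiv ℝ f q w) p v := by
  have hd : DifferentiableAt ℝ (fderiv ℝ f) p :=
    (hf.fderiv_right (m := 1) (by norm_num)).differentiable one_ne_zero p
  have hsymm : IsSymmSndFDerivAt ℝ f p := hf.contDiffAt.isSymmSndFDerivAt (by simp)
  rw [fderiv_clm_apply hd (by fun_prop), fderiv_clm_apply hd (by fun_prop)]
  simpa using hsymm.eq w v

theorem rpow_three_halves_eq_sqrt_pow {x : ℝ} (hx : 0 ≤ x) : x ^ ((3 : ℝ) / 2) = √x ^ 3 := by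
  rw [Real.sqrt_eq_rpow, ← Real.rpow_natCast, ← Real.rpow_mul hx]
  norm_num

theorem HasDerivAt.sqrt_sq_add_sq {u v : ℝ → ℝ} {u' v' x : ℝ} (hu : HasDerivAt u u' x)
    (hv : HasDerivAt v v' x) (h : u x ^ 2 + v x ^ 2 ≠ 0) :
    HasDerivAt (fun y => √(u y ^ 2 + v y ^ 2))
      ((u x * u' + v x * v') / √(u x ^ 2 + v x ^ 2)) x := by
  convert ((hu.fun_pow 2).fun_add (hv.fun_pow 2)).sqrt h using 1
  push_cast
  ring

theorem stmt13 (H : ℝ → ℝ → ℝ)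
    (hH : ContDiff ℝ 2 (fun p : ℝ × ℝ => H p.1 p.2))
    (hper : ∀ s θ : ℝ, H s (θ + 2 * Real.pi) = H s θ)
    (hpos : ∀ s θ : ℝ, 0 < H s θ) :
    ∀ s : ℝ,
      HasDerivAt
        (fun t => ∫ θ in (0:ℝ)..(2 * Real.pi),
          Real.sqrt (H t θ ^ 2 + deriv (H t) θ ^ 2))
        (∫ θ in (0:ℝ)..(2 * Real.pi),
          deriv (fun t => H t θ) s * H s θ *
            ((H s θ ^ 2 + 2 * deriv (H s) θ ^ 2 - H s θ * deriv (deriv (H s)) θ)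
              / (H s θ ^ 2 + deriv (H s) θ ^ 2) ^ ((3:ℝ)/2)))
        s := by
  intro s
  set f : ℝ × ℝ → ℝ := fun p => H p.1 p.2
  set A : ℝ × ℝ → ℝ := fun q => fderiv ℝ f q (1, 0) with hA
  set B : ℝ × ℝ → ℝ := fun q => fderiv ℝ f q (0, 1)
  have hf' : ContDiff ℝ 1 (fderiv ℝ f) := hH.fderiv_right (by norm_num)
  have hA1 : ContDiff ℝ 1 A := hf'.clm_apply contDiff_const
  have hB1 : ContDiff ℝ 1 B := hf'.clm_apply contDiff_const
  have hfd : Differentiable ℝ f := hH.differentiable two_ne_zero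
  have hAd : Differentiable ℝ A := hA1.differentiable one_ne_zero
  have hBd : Differentiable ℝ B := hB1.differentiable one_ne_zero
  set M : ℝ × ℝ → ℝ := fun q => fderiv ℝ B q (1, 0)
  set N : ℝ × ℝ → ℝ := fun q => fderiv ℝ B q (0, 1)
  have hMc : Continuous M := (hB1.continuous_fderiv one_ne_zero).clm_apply continuous_const
  have hNc : Continuous N := (hB1.continuous_fderiv one_ne_zero).clm_apply continuous_const
  have hHs (t θ : ℝ) : HasDerivAt (fun t => H t θ) (A (t, θ)) t :=
    hasDerivAt_fst_of_differentiable hfd t θ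
  have hHθ (t θ : ℝ) : HasDerivAt (H t) (B (t, θ)) θ :=
    hasDerivAt_snd_of_differentiable hfd t θ
  have hBs (t θ : ℝ) : HasDerivAt (fun t => B (t, θ)) (M (t, θ)) t :=
    hasDerivAt_fst_of_differentiable hBd t θ
  have hBθ (t θ : ℝ) : HasDerivAt (fun θ => B (t, θ)) (N (t, θ)) θ :=
    hasDerivAt_snd_of_differentiable hBd t θ
  have hAθ (t θ : ℝ) : HasDerivAt (fun θ => A (t, θ)) (M (t, θ)) θ := by
    have h := hasDerivAt_snd_of_differentiable hAd t θ
    rwa [hA, fderiv_fderiv_apply_comm hH] at h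
  have hdB (t : ℝ) : deriv (H t) = fun θ => B (t, θ) := funext fun θ => (hHθ t θ).deriv
  have hdA (t θ : ℝ) : deriv (fun t => H t θ) t = A (t, θ) := (hHs t θ).deriv
  have hdN (t θ : ℝ) : deriv (fun θ => B (t, θ)) θ = N (t, θ) := (hBθ t θ).deriv
  simp only [hdB, hdA, hdN]
  have hAper : A (s, 2 * π) = A (s, 0) := by
    rw [← hdA, ← hdA]
    congr 1
    funext t
    simpa using hper t 0
  have hBper : B (s, 2 * π) = B (s, 0) := by
    rw [← (hHθ s (2 * π)).deriv, ← (hHθ s 0).deriv]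
    have h := deriv_comp_add_const (H s) (2 * π) 0
    simp only [hper s, zero_add] at h
    exact h.symm
  have hHper : H s (2 * π) = H s 0 := by simpa using hper s 0
  have hfc : Continuous fun p : ℝ × ℝ => H p.1 p.2 := hH.continuous
  have hAc : Continuous A := hA1.continuous
  have hBc : Continuous B := hB1.continuous
  have hQ (t θ : ℝ) : 0 < H t θ ^ 2 + B (t, θ) ^ 2 := by
    have := hpos t θ
    positivity
  have hR (t θ : ℝ) : 0 < √(H t θ ^ 2 + B (t, θ) ^ 2) := Real.sqrt_pos.2 (hQ t θ)
  have hHc (t : ℝ) : Continuous (H t) := hfc.comp (Continuous.prodMk_right t)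
  have hDc : Continuous fun p : ℝ × ℝ => (H p.1 p.2 * A p + B p * M p) /
      √(H p.1 p.2 ^ 2 + B p ^ 2) :=
    Continuous.div (by fun_prop) (by fun_prop) fun p => (hR p.1 p.2).ne'
  have hderiv := hasDerivAt_intervalIntegral_of_continuous 0 (2 * π)
    (G := fun t θ => √(H t θ ^ 2 + B (t, θ) ^ 2))
    (D := fun t θ => (H t θ * A (t, θ) + B (t, θ) * M (t, θ)) / √(H t θ ^ 2 + B (t, θ) ^ 2))
    (fun t => by have := hHc t; fun_prop) hDc
    (fun t θ => (hHs t θ).sqrt_sq_add_sq (hBs t θ) (hQ t θ).ne') s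
  convert hderiv using 1
  have hHsc := hHc s
  have hkc : Continuous fun θ => A (s, θ) * H s θ *
      ((H s θ ^ 2 + 2 * B (s, θ) ^ 2 - H s θ * N (s, θ)) /
        (H s θ ^ 2 + B (s, θ) ^ 2) ^ ((3 : ℝ) / 2)) := by
    refine Continuous.mul (by fun_prop) (Continuous.div (by fun_prop) ?_ fun θ =>
      (Real.rpow_pos_of_pos (hQ s θ) _).ne')
    exact Continuous.rpow_const (by fun_prop) fun θ => Or.inl (hQ s θ).ne'
  have hDsc : Continuous fun θ => (H s θ * A (s, θ) + B (s, θ) * M (s, θ)) /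
      √(H s θ ^ 2 + B (s, θ) ^ 2) := hDc.comp (Continuous.prodMk_right s)
  symm
  rw [← sub_eq_zero, ← integral_sub (hDsc.intervalIntegrable _ _) (hkc.intervalIntegrable _ _)]
  rw [integral_eq_sub_of_hasDerivAt
    (f := fun θ => A (s, θ) * (B (s, θ) / √(H s θ ^ 2 + B (s, θ) ^ 2))) _
    ((hDsc.fun_sub hkc).intervalIntegrable _ _)]
  · simp only [hAper, hBper, hHper, sub_self]
  intro θ _
  refine ((hAθ s θ).fun_mul ((hBθ s θ).fun_div
    ((hHθ s θ).sqrt_sq_add_sq (hBθ s θ) (hQ s θ).ne') (hR s θ).ne')).congr_deriv ?_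
  have h0 := (hR s θ).ne'
  have h2 := Real.sq_sqrt (hQ s θ).le
  rw [rpow_three_halves_eq_sqrt_pow (hQ s θ).le]
  set r := √(H s θ ^ 2 + B (s, θ) ^ 2)
  field_simp
  linear_combination (A (s, θ) * N (s, θ) - A (s, θ) * H s θ) * h2
end
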